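/- (Expansion of shifted reachable sets.) Let c : ℝ×ℝ^d → [0,∞) and v : ℝ×ℝ^d → ℝ^d be measurable, and suppose there is M ≥ 1 such that B_{t/M}(x) ⊆ Γ(t; t_1, x) for every (t_1, x) ∈ ℝ^{d+1} and every t ≥ M. Then for any (t_0, x_0, z) with s ≥ M(|z − x_0| + 1), any t ≥ 0, and any s' ≥ M, one has B_{s'/M}(Γ(t; t_0+s, z)) ⊆ Γ(t+s+s'; t_0, x_0), where B_r(G) := { x : dist(x, G) < r } denotes the open r-neighborhood of G. -/

import Mathlib

open MeasureTheory Filter Metric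

noncomputable section

/-- `ℝ^d` with the Euclidean norm. -/
abbrev Euc (d : ℕ) : Type := EuclideanSpace ℝ (Fin d)

/-- `(t₁, x₁)` is reachable from `(t₀, x₀)`: there is an absolutely continuous path
`γ : [t₀,t₁] → ℝ^d` (given by the integral of its a.e. derivative `g`) with `γ(t₀) = x₀`,
`γ(t₁) = x₁`, and `|γ'(t) − v(t,γ(t))| ≤ c(t,γ(t))` for a.e. `t ∈ [t₀,t₁]`. -/
def Reachable {d : ℕ} (c : ℝ → Euc d → ℝ) (v : ℝ → Euc d → Euc d)
    (t0 : ℝ) (x0 : Euc d) (t1 : ℝ) (x1 : Euc d) : Prop :=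
  t0 ≤ t1 ∧ ∃ γ g : ℝ → Euc d,
    IntervalIntegrable g volume t0 t1 ∧
    (∀ t ∈ Set.Icc t0 t1, γ t = x0 + ∫ s in t0..t, g s) ∧
    γ t1 = x1 ∧
    ∀ᵐ s ∂(volume.restrict (Set.Icc t0 t1)), ‖g s - v s (γ s)‖ ≤ c s (γ s)

/-- The reachable set `Γ(t; t₀, x₀)`. -/
def reachSet {d : ℕ} (c : ℝ → Euc d → ℝ) (v : ℝ → Euc d → Euc d)
    (t t0 : ℝ) (x0 : Euc d) : Set (Euc d) :=
  {x | Reachable c v t0 x0 (t0 + t) x}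

theorem Reachable.trans_aux {d : ℕ} {c : ℝ → Euc d → ℝ} {v : ℝ → Euc d → Euc d}
    {a b e : ℝ} {x y w : Euc d} (h1 : Reachable c v a x b y) (h2 : Reachable c v b y e w) :
    Reachable c v a x e w := by
  obtain ⟨hab, γ1, g1, hi1, hγ1, hy, hae1⟩ := h1
  obtain ⟨hbe, γ2, g2, hi2, hγ2, hw, hae2⟩ := h2
  have e1 : ∀ t ∈ Set.Icc a b, Set.EqOn (fun s => if s ≤ b then g1 s else g2 s) g1 (Set.uIoc a t) := by
    intro t ht s hs
    rw [Set.uIoc_of_le ht.1] at hs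
    simp only [if_pos (hs.2.trans ht.2)]
  have e2 : ∀ t, b ≤ t → Set.EqOn (fun s => if s ≤ b then g1 s else g2 s) g2 (Set.uIoc b t) := by
    intro t ht s hs
    rw [Set.uIoc_of_le ht] at hs
    simp only [if_neg (not_le.2 hs.1)]
  have hI1 : IntervalIntegrable (fun s => if s ≤ b then g1 s else g2 s) volume a b :=
    hi1.congr (e1 b ⟨hab, le_rfl⟩).symm
  have hI2 : IntervalIntegrable (fun s => if s ≤ b then g1 s else g2 s) volume b e :=
    hi2.congr (e2 e hbe).symm
  have hyb : x + ∫ s in a..b, g1 s = y := by rw [← hγ1 b ⟨hab, le_rfl⟩, hy]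
  have hγb : γ2 b = y := by
    have := hγ2 b ⟨le_rfl, hbe⟩
    simpa using this
  refine ⟨hab.trans hbe, fun s => if s ≤ b then γ1 s else γ2 s,
    fun s => if s ≤ b then g1 s else g2 s, hI1.trans hI2, ?_, ?_, ?_⟩
  · intro t ht
    by_cases htb : t ≤ b
    · simp only [if_pos htb]
      rw [hγ1 t ⟨ht.1, htb⟩,
        intervalIntegral.integral_congr_ae (ae_of_all _ (e1 t ⟨ht.1, htb⟩))]
    · have hbt : b ≤ t := (not_le.1 htb).le
      simp only [if_neg htb]
      have hI2' : IntervalIntegrable (fun s => if s ≤ b then g1 s else g2 s) volume b t := by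
        refine hI2.mono_set ?_
        rw [Set.uIcc_of_le hbt, Set.uIcc_of_le hbe]
        exact Set.Icc_subset_Icc_right ht.2
      rw [← intervalIntegral.integral_add_adjacent_intervals hI1 hI2',
        intervalIntegral.integral_congr_ae (ae_of_all _ (e1 b ⟨hab, le_rfl⟩)),
        intervalIntegral.integral_congr_ae (ae_of_all _ (e2 t hbt)), ← add_assoc, hyb,
        hγ2 t ⟨hbt, ht.2⟩]
  · by_cases heb : e ≤ b
    · have : e = b := le_antisymm heb hbe
      subst this
      simp only [le_refl, if_true]
      rw [hy, ← hγb, hw]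
    · simp only [if_neg heb, hw]
  · rw [ae_restrict_iff' measurableSet_Icc] at hae1 hae2 ⊢
    filter_upwards [hae1, hae2] with s k1 k2 hs
    by_cases hsb : s ≤ b
    · simp only [if_pos hsb]
      exact k1 ⟨hs.1, hsb⟩
    · simp only [if_neg hsb]
      exact k2 ⟨(not_le.1 hsb).le, hs.2⟩

/-- **Expansion of shifted reachable sets.**  If every point expands at least at speed `1/M`
after time `M`, then for `s ≥ M(|z − x₀| + 1)`, `t ≥ 0` and `s' ≥ M`, the open
`s'/M`-neighborhood of `Γ(t; t₀+s, z)` is contained in `Γ(t+s+s'; t₀, x₀)`. -/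
theorem reachSet_thickening_subset
    {d : ℕ} (c : ℝ → Euc d → ℝ) (v : ℝ → Euc d → Euc d)
    (hc0 : ∀ t x, 0 ≤ c t x)
    (hcmeas : Measurable (Function.uncurry c)) (hvmeas : Measurable (Function.uncurry v))
    (M : ℝ) (hM : 1 ≤ M)
    (hgrow : ∀ t1 : ℝ, ∀ x : Euc d, ∀ t : ℝ, M ≤ t →
      Metric.ball x (t / M) ⊆ reachSet c v t t1 x)
    (t0 : ℝ) (x0 z : Euc d) (s : ℝ) (hs : M * (‖z - x0‖ + 1) ≤ s)
    (t : ℝ) (ht : 0 ≤ t) (s' : ℝ) (hs' : M ≤ s') :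
    Metric.thickening (s' / M) (reachSet c v t (t0 + s) z)
      ⊆ reachSet c v (t + s + s') t0 x0 := by
  intro p hp
  obtain ⟨q, hq, hpq⟩ := Metric.mem_thickening_iff.1 hp
  have hM0 : 0 < M := by linarith
  have hsM : M ≤ s := by nlinarith [norm_nonneg (z - x0)]
  have h1 : Reachable c v t0 x0 (t0 + s) z := by
    apply hgrow t0 x0 s hsM
    rw [Metric.mem_ball, dist_eq_norm, lt_div_iff₀ hM0]
    nlinarith
  have h2 : Reachable c v (t0 + s) z (t0 + s + t) q := hq
  have h3 : Reachable c v (t0 + s + t) q (t0 + s + t + s') p :=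
    hgrow (t0 + s + t) q s' hs' hpq
  have h4 := (h1.trans_aux h2).trans_aux h3
  have e : t0 + s + t + s' = t0 + (t + s + s') := by ring
  rw [e] at h4
  exact h4
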